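/- Let ρ : ℝ → ℝ be a continuous 2π-periodic function such that (i) ρ is not constant on any nondegenerate interval, and (ii) the set of residues modulo 2π of points at which ρ attains a local minimum or a local maximum has at most three elements. Then there exist real numbers t₁ and t₂ with t₁ < t₂ < t₁ + 2π such that ρ(t₁) = min ρ, ρ(t₂) = max ρ, ρ is strictly increasing on [t₁, t₂], and ρ is strictly decreasing on [t₂, t₁ + 2π]. (This is Lemma 3.1: for a plane convex body K with at most three equilibrium points, every local extremum of the radial function ρ_K measured from the centroid yields an equilibrium point, so ρ_K, viewed as a 2π-periodic function, satisfies the hypotheses, and hence is strictly monotone on the two arcs between an absolute minimum point and an absolute maximum point.) -/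

import Mathlib

open Real Set

/-- A continuous function on an interval whose endpoint values are its extreme values, and which
is not constant on any nondegenerate interval, is either strictly increasing or has a local maximum
followed by a local minimum in the interior. -/
lemma strictMonoOn_or_exists_isLocalMax_isLocalMin {f : ℝ → ℝ} (hf : Continuous f)
    (hnc : ∀ a b : ℝ, a < b → ∃ x ∈ Icc a b, ∃ y ∈ Icc a b, f x ≠ f y) {a b : ℝ}
    (ha : ∀ t, f a ≤ f t) (hb : ∀ t, f t ≤ f b) :
    StrictMonoOn f (Icc a b) ∨
      ∃ p q, a < p ∧ p < q ∧ q < b ∧ IsLocalMax f p ∧ IsLocalMin f q := by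
  refine or_iff_not_imp_left.2 fun hmono => ?_
  obtain ⟨x, y, hax, hxy, hyb, hlt⟩ :
      ∃ x y, a ≤ x ∧ x < y ∧ y ≤ b ∧ f y < f x := by
    by_contra! H
    refine hmono fun x hx y hy hxy => (H x y hx.1 hxy hy.2).lt_of_ne fun heq => ?_
    have hconst : ∀ z ∈ Icc x y, f z = f x := by
      intro z hz
      rcases hz.1.eq_or_lt with rfl | h1
      · rfl
      rcases hz.2.eq_or_lt with rfl | h2
      · exact heq.symm
      exact le_antisymm (heq ▸ H z y (hx.1.trans hz.1) h2 hy.2)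
        (H x z hx.1 h1 (hz.2.trans hy.2))
    obtain ⟨u, hu, v, hv, huv⟩ := hnc x y hxy
    exact huv ((hconst u hu).trans (hconst v hv).symm)
  obtain ⟨p, hp, hpmax⟩ := isCompact_Icc.exists_isMaxOn
    (nonempty_Icc.2 (hax.trans hxy.le)) hf.continuousOn
  have hxp : f x ≤ f p := hpmax ⟨hax, hxy.le⟩
  have hap : a < p := hp.1.lt_of_ne fun h => by
    subst h
    linarith [ha y]
  have hpy : p < y := hp.2.lt_of_ne fun h => by
    subst h
    linarith
  obtain ⟨q, hq, hqmin⟩ := isCompact_Icc.exists_isMinOn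
    (nonempty_Icc.2 (hpy.le.trans hyb)) hf.continuousOn
  have hqy : f q ≤ f y := hqmin ⟨hpy.le, hyb⟩
  have hpq : p < q := hq.1.lt_of_ne fun h => by
    subst h
    linarith
  have hqb : q < b := hq.2.lt_of_ne fun h => by
    subst h
    linarith [hb x]
  exact ⟨p, q, hap, hpq, hqb, hpmax.isLocalMax (Icc_mem_nhds hap hpy),
    hqmin.isLocalMin (Icc_mem_nhds hpq hqb)⟩

/-- Four distinct points in a half-open period cannot lie in three residue classes. -/
lemma not_four_points_three_residues {T : ℝ} {s₁ s₂ s₃ : ℝ} {P : Fin 4 → ℝ} (hP : StrictMono P)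
    (hPT : P 3 < P 0 + T)
    (h : ∀ i, (∃ k : ℤ, P i = s₁ + k * T) ∨ (∃ k : ℤ, P i = s₂ + k * T) ∨
      (∃ k : ℤ, P i = s₃ + k * T)) : False := by
  have hs : ∀ i, ∃ (c : Fin 3) (k : ℤ), P i = ![s₁, s₂, s₃] c + k * T := by
    intro i
    rcases h i with h | h | h
    · exact ⟨0, h⟩
    · exact ⟨1, h⟩
    · exact ⟨2, h⟩
  choose c k hck using hs
  obtain ⟨i, j, hij, hc⟩ := Fintype.exists_ne_map_eq_of_card_lt c (by simp)
  wlog hlt : i < j generalizing i j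
  · exact this j i hij.symm hc.symm (hij.lt_or_gt.resolve_left hlt)
  have h0 : P 0 < P 3 := hP (by decide)
  have hT : 0 < T := by linarith
  have h1 : P i < P j := hP hlt
  have h2 : P 0 ≤ P i := hP.monotone (Fin.zero_le i)
  have h3 : P j ≤ P 3 := hP.monotone (Fin.le_last j)
  have hi := hck i
  have hj := hck j
  rw [hc] at hi
  have hpos : (0 : ℝ) < ((k j - k i : ℤ) : ℝ) := by
    push_cast
    by_contra! hle
    nlinarith
  have hone : ((k j - k i : ℤ) : ℝ) < 1 := by
    push_cast
    by_contra! hle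
    nlinarith
  have h4 : 0 < k j - k i := by exact_mod_cast hpos
  have h5 : k j - k i < 1 := by exact_mod_cast hone
  omega

/-- Lemma 3.1: a continuous `2π`-periodic function which is not constant on any nondegenerate
interval and whose set of local extremum points has at most three residues modulo `2π`
is strictly increasing, then strictly decreasing, between a global minimum point and a global
maximum point lying within one period. -/
theorem stmt_4 (ρ : ℝ → ℝ) (hcont : Continuous ρ) (hper : Function.Periodic ρ (2 * π))
    (hnc : ∀ a b : ℝ, a < b → ∃ x ∈ Icc a b, ∃ y ∈ Icc a b, ρ x ≠ ρ y)
    (hext : ∃ s₁ s₂ s₃ : ℝ, ∀ t : ℝ, (IsLocalMin ρ t ∨ IsLocalMax ρ t) →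
      (∃ k : ℤ, t = s₁ + k * (2 * π)) ∨ (∃ k : ℤ, t = s₂ + k * (2 * π)) ∨
      (∃ k : ℤ, t = s₃ + k * (2 * π))) :
    ∃ t₁ t₂ : ℝ, t₁ < t₂ ∧ t₂ < t₁ + 2 * π ∧
      (∀ t : ℝ, ρ t₁ ≤ ρ t) ∧ (∀ t : ℝ, ρ t ≤ ρ t₂) ∧
      StrictMonoOn ρ (Icc t₁ t₂) ∧ StrictAntiOn ρ (Icc t₂ (t₁ + 2 * π)) := by
  obtain ⟨s₁, s₂, s₃, hs⟩ := hext
  have hT : 0 < 2 * π := two_pi_pos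
  obtain ⟨t₁, -, hmin⟩ := isCompact_Icc.exists_isMinOn
    (nonempty_Icc.2 hT.le) hcont.continuousOn (f := ρ)
  have h1 : ∀ t, ρ t₁ ≤ ρ t := fun t => by
    obtain ⟨y, hy, hyt⟩ := hper.exists_mem_Ico₀ hT t
    exact hyt ▸ hmin (Ico_subset_Icc_self hy)
  obtain ⟨t₂, ht₂, hmax⟩ := isCompact_Icc.exists_isMaxOn
    (nonempty_Icc.2 (by linarith : t₁ ≤ t₁ + 2 * π)) hcont.continuousOn (f := ρ)
  have h2 : ∀ t, ρ t ≤ ρ t₂ := fun t => by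
    obtain ⟨y, hy, hyt⟩ := hper.exists_mem_Ico hT t t₁
    exact hyt ▸ hmax (Ico_subset_Icc_self hy)
  have hne : ρ t₁ ≠ ρ t₂ := fun h => by
    obtain ⟨x, -, y, -, hxy⟩ := hnc 0 1 one_pos
    exact hxy (le_antisymm (by linarith [h1 y, h2 x]) (by linarith [h1 x, h2 y]))
  have h12 : t₁ < t₂ := ht₂.1.lt_of_ne fun h => hne (h ▸ rfl)
  have h21 : t₂ < t₁ + 2 * π := ht₂.2.lt_of_ne fun h => hne (by rw [h, hper])
  have hl1 : IsLocalMin ρ t₁ := Filter.Eventually.of_forall h1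
  have hl2 : IsLocalMax ρ t₂ := Filter.Eventually.of_forall h2
  refine ⟨t₁, t₂, h12, h21, h1, h2, ?_, ?_⟩
  · refine (strictMonoOn_or_exists_isLocalMax_isLocalMin hcont hnc h1 h2).resolve_right ?_
    rintro ⟨p, q, hp, hpq, hq, hpm, hqm⟩
    refine not_four_points_three_residues (P := ![t₁, p, q, t₂]) (T := 2 * π) ?_ h21
      (s₁ := s₁) (s₂ := s₂) (s₃ := s₃) fun i => hs _ ?_
    · refine Fin.strictMono_iff_lt_succ.2 fun i => ?_
      fin_cases i
      exacts [hp, hpq, hq]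
    · fin_cases i
      exacts [.inl hl1, .inr hpm, .inl hqm, .inr hl2]
  · have hmono := (strictMonoOn_or_exists_isLocalMax_isLocalMin (f := fun t => -ρ t)
      (a := t₂) (b := t₁ + 2 * π) hcont.neg (by simpa using hnc)
      (fun t => neg_le_neg (h2 t)) (fun t => by simpa [hper t₁] using h1 t)).resolve_right ?_
    · exact fun x hx y hy hxy => neg_lt_neg_iff.1 (hmono hx hy hxy)
    rintro ⟨p, q, hp, hpq, hq, hpm, hqm⟩
    have hpm' : IsLocalMin ρ p := by simpa using hpm.neg
    have hqm' : IsLocalMax ρ q := by simpa using hqm.neg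
    refine not_four_points_three_residues (P := ![t₁, t₂, p, q]) (T := 2 * π) ?_ hq
      (s₁ := s₁) (s₂ := s₂) (s₃ := s₃) fun i => hs _ ?_
    · refine Fin.strictMono_iff_lt_succ.2 fun i => ?_
      fin_cases i
      exacts [h12, hp, hpq]
    · fin_cases i
      exacts [.inl hl1, .inr hl2, .inl hpm', .inr hqm']
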